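/- The free group F₂ does not split as a proper amalgamated product along a non-trivial malnormal subgroup: there are no subgroups A, B of F₂ such that C = A ∩ B is non-trivial and malnormal in F₂, A ≠ C, B ≠ C, and the canonical homomorphism to F₂ from the amalgamated free product of the inclusions C ↪ A and C ↪ B is an isomorphism. -/

import Mathlib

/-- The two-element family of subgroups `A`, `B`. -/
def amalgFam {G : Type*} [Group G] (A B : Subgroup G) : Bool → Subgroup G :=
  fun b => bif b then A else B

theorem inf_le_amalgFam {G : Type*} [Group G] (A B : Subgroup G) (b : Bool) :
    A ⊓ B ≤ amalgFam A B b := by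
  cases b
  · exact inf_le_right
  · exact inf_le_left

/-- The diagram of inclusions `A ∩ B ↪ A`, `A ∩ B ↪ B`. -/
def amalgMaps {G : Type*} [Group G] (A B : Subgroup G) :
    ∀ b : Bool, ↥(A ⊓ B) →* ↥(amalgFam A B b) :=
  fun b => Subgroup.inclusion (inf_le_amalgFam A B b)

/-- The canonical homomorphism from the amalgamated free product (pushout) of the
inclusions `A ∩ B ↪ A` and `A ∩ B ↪ B` back to `G`. -/
def amalgToGroup {G : Type*} [Group G] (A B : Subgroup G) :
    Monoid.PushoutI (amalgMaps A B) →* G :=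
  Monoid.PushoutI.lift (fun b => (amalgFam A B b).subtype) (A ⊓ B).subtype
    (fun b => by ext x; rfl)

/-- `G` splits as a proper amalgamated product `A ∗_{A ∩ B} B`. -/
def SplitsAsAmalgam {G : Type*} [Group G] (A B : Subgroup G) : Prop :=
  A ≠ A ⊓ B ∧ B ≠ A ⊓ B ∧ Function.Bijective (amalgToGroup A B)

/-- A subgroup `C` of `G` is malnormal if `gCg⁻¹ ∩ C = 1` for all `g ∉ C`. -/
def IsMalnormal {G : Type*} [Group G] (C : Subgroup G) : Prop :=
  ∀ g : G, g ∉ C → ∀ c ∈ C, g * c * g⁻¹ ∈ C → c = 1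

namespace SimpleGraph

variable {V : Type*} {T : SimpleGraph V}

/-- In a tree, a vertex has at most one neighbour closer to a given vertex. -/
theorem IsTree.eq_of_adj_of_dist_add_one (hT : T.IsTree) {b w w' p : V} (hw : T.Adj b w)
    (hw' : T.Adj b w') (h : T.dist w p + 1 = T.dist b p) (h' : T.dist w' p + 1 = T.dist b p) :
    w = w' := by
  obtain ⟨r, -, hr⟩ := hT.connected.exists_path_of_dist w p
  obtain ⟨r', -, hr'⟩ := hT.connected.exists_path_of_dist w' p
  have h₁ : (Walk.cons hw r).IsPath :=
    Walk.isPath_of_length_eq_dist _ (by rw [Walk.length_cons, hr, h])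
  have h₂ : (Walk.cons hw' r').IsPath :=
    Walk.isPath_of_length_eq_dist _ (by rw [Walk.length_cons, hr', h'])
  have := hT.isAcyclic.subsingleton_path b p
  simpa using congrArg (fun q : T.Path b p => q.1.snd)
    (Subsingleton.elim (⟨_, h₁⟩ : T.Path b p) ⟨_, h₂⟩)

theorem Connected.exists_adj_dist_add_one (hT : T.Connected) {p q : V} (h : p ≠ q) :
    ∃ m, T.Adj p m ∧ T.dist m q + 1 = T.dist p q := by
  obtain ⟨r, hr⟩ := hT.exists_walk_length_eq_dist p q
  cases r with
  | nil => exact absurd rfl h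
  | @cons _ m _ hm r =>
    refine ⟨m, hm, ?_⟩
    have h₁ := dist_le r
    have h₂ := hT.dist_triangle (u := p) (v := m) (w := q)
    have h₃ := dist_eq_one_iff_adj.2 hm
    rw [Walk.length_cons] at hr
    omega

/-- Geodesics leaving a vertex of a tree in different directions concatenate to a geodesic. -/
theorem IsTree.dist_eq_add_of_ne (hT : T.IsTree) {p q : V} :
    ∀ {b w w' : V}, T.Adj b w → T.Adj b w' → w ≠ w' → T.dist w p + 1 = T.dist b p →
      T.dist w' q + 1 = T.dist b q → T.dist p q = T.dist b p + T.dist b q := by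
  intro b
  induction hn : T.dist b q generalizing b with
  | zero => intro w w' _ _ _ _ h; omega
  | succ n ih =>
    intro w w' hw hw' hne h h'
    have h₁ : T.dist w' p = T.dist b p + 1 := by
      rcases hT.dist_eq_dist_add_one_of_adj p hw' with e | e
      · refine absurd (hT.eq_of_adj_of_dist_add_one hw hw' h ?_) hne
        rw [dist_comm, ← e, dist_comm]
      · rw [dist_comm, e, dist_comm]
    rcases eq_or_ne w' q with rfl | hq
    · rw [dist_self] at h'
      rw [dist_comm, h₁]; omega
    · obtain ⟨m, hm, hm'⟩ := hT.connected.exists_adj_dist_add_one hq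
      have := ih (b := w') (by omega) hw'.symm hm (by rintro rfl; omega) h₁.symm (by omega)
      omega

/-- The four-point condition for trees, in its Gromov product form. -/
theorem IsTree.dist_four_point (hT : T.IsTree) (b p q r : V) :
    T.dist p q + T.dist b r ≤ T.dist p r + T.dist b q ∨
      T.dist p q + T.dist b r ≤ T.dist q r + T.dist b p := by
  have t (b : V) : T.dist p q ≤ T.dist b p + T.dist b q := by
    simpa [dist_comm] using hT.connected.dist_triangle (u := p) (v := b) (w := q)
  induction hn : T.dist b r generalizing b with
  | zero =>
    obtain rfl := hT.connected.dist_eq_zero_iff.1 hn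
    have := t b
    rw [dist_comm (u := b) (v := p)] at this
    omega
  | succ n ih =>
    have hr : b ≠ r := by rintro rfl; simp at hn
    rcases eq_or_ne b p with rfl | hp
    · omega
    rcases eq_or_ne b q with rfl | hq
    · rw [dist_comm (u := p)]
      omega
    obtain ⟨u, hu, hu'⟩ := hT.connected.exists_adj_dist_add_one hp
    obtain ⟨v, hv, hv'⟩ := hT.connected.exists_adj_dist_add_one hq
    obtain ⟨w, hw, hw'⟩ := hT.connected.exists_adj_dist_add_one hr
    have := t b
    rcases eq_or_ne u w with rfl | h₁
    · rcases eq_or_ne v u with rfl | h₂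
      · have := ih v (by omega)
        omega
      · have := hT.dist_eq_add_of_ne hv hw h₂ hv' hw'
        omega
    · have := hT.dist_eq_add_of_ne hu hw h₁ hu' hw'
      omega

theorem IsTree.even_dist (hT : T.IsTree) (p q r : V) :
    Even (T.dist p q + T.dist q r + T.dist p r) := by
  obtain ⟨w⟩ := hT.connected q r
  induction w with
  | nil => simp [← two_mul]
  | @cons a b c h w ih =>
    have h₁ := hT.dist_eq_dist_add_one_of_adj p h
    have h₂ := hT.dist_eq_dist_add_one_of_adj c h
    rw [dist_comm (u := c), dist_comm (u := c)] at h₂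
    grind

end SimpleGraph

namespace SimpleGraph

variable {V : Type*} {T : SimpleGraph V}

theorem IsTree.exists_dist_eq (hT : T.IsTree) (v p : V) {r : ℕ} (hr : r ≤ T.dist v p) :
    ∃ m, T.dist v m = r ∧ T.dist m p + r = T.dist v p := by
  induction r with
  | zero => exact ⟨v, by simp⟩
  | succ r ih =>
    obtain ⟨m, h₁, h₂⟩ := ih (by omega)
    obtain ⟨n, h₃, h₄⟩ := hT.connected.exists_adj_dist_add_one (p := m) (q := p) (by
      rintro rfl
      rw [dist_self] at h₂
      omega)
    have h₅ := hT.connected.dist_triangle (u := v) (v := m) (w := n)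
    have h₆ := hT.connected.dist_triangle (u := v) (v := n) (w := p)
    have := dist_eq_one_iff_adj.2 h₃
    exact ⟨n, by omega, by omega⟩

/-- Two geodesics with the same origin agree up to their Gromov product. -/
theorem IsTree.eq_of_dist_eq (hT : T.IsTree) {v p q m n : V} {r : ℕ} (hm : T.dist v m = r)
    (hm' : T.dist m p + r = T.dist v p) (hn : T.dist v n = r) (hn' : T.dist n q + r = T.dist v q)
    (h : T.dist p q + 2 * r ≤ T.dist v p + T.dist v q) : m = n := by
  have h₁ := hT.dist_four_point v m q p
  have h₂ := hT.dist_four_point v m n q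
  rw [dist_comm (u := q) (v := p)] at h₁
  exact hT.connected.dist_eq_zero_iff.1 (by omega)

variable (T) in
/-- `T.SameDir v p q` says that the geodesics of the tree `T` from `v` to `p` and to `q` have a
common first edge. -/
def SameDir (v p q : V) : Prop :=
  T.dist p q + 2 ≤ T.dist v p + T.dist v q

theorem SameDir.symm {v p q : V} (h : T.SameDir v p q) : T.SameDir v q p := by
  unfold SameDir at *
  rw [dist_comm (u := q)]
  omega

theorem SameDir.trans (hT : T.IsTree) {v p q r : V} (h : T.SameDir v p q)
    (h' : T.SameDir v q r) : T.SameDir v p r := by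
  unfold SameDir at *
  have := hT.dist_four_point v p r q
  rw [dist_comm (u := r) (v := q)] at this
  omega

theorem IsTree.dist_eq_of_not_sameDir (hT : T.IsTree) {v p q : V} (h : ¬ T.SameDir v p q) :
    T.dist p q = T.dist v p + T.dist v q := by
  unfold SameDir at h
  have h₁ := hT.even_dist v p q
  have h₂ := hT.connected.dist_triangle (u := p) (v := v) (w := q)
  rw [dist_comm (u := p) (v := v)] at h₂
  grind

theorem SameDir.ne {v p q : V} (h : T.SameDir v p q) : v ≠ p := by
  rintro rfl
  simp [SameDir] at h

theorem SameDir.dist_add_one (hT : T.IsTree) {v p q m : V} (h : T.SameDir v p q)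
    (hm : T.Adj v m) (hmp : T.dist m p + 1 = T.dist v p) : T.dist m q + 1 = T.dist v q := by
  have h₁ := hT.dist_four_point v m q p
  have h₂ := hT.connected.dist_triangle (u := v) (v := m) (w := q)
  have := dist_eq_one_iff_adj.2 hm
  rw [dist_comm (u := q) (v := p)] at h₁
  unfold SameDir at h
  omega

/-- Neighbours of `v` on geodesics in the same direction agree. -/
theorem SameDir.eq (hT : T.IsTree) {v p q m n : V} (h : T.SameDir v p q)
    (hm : T.Adj v m) (hmp : T.dist m p + 1 = T.dist v p)
    (hn : T.Adj v n) (hnq : T.dist n q + 1 = T.dist v q) : m = n :=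
  hT.eq_of_adj_of_dist_add_one hm hn (h.dist_add_one hT hm hmp) hnq

end SimpleGraph

open SimpleGraph

/-- An action of a group `G` on a tree `T` without inversions, in which no nontrivial element
fixes two distinct edges with a common vertex, elements with a power fixing an edge fix that edge,
vertex stabilisers are not cyclic and there is no global fixed vertex. -/
structure IsMalnormalTreeAction (G : Type*) [Group G] {V : Type*} [MulAction G V]
    (T : SimpleGraph V) : Prop where
  isTree : T.IsTree
  adj_smul (g : G) {p q : V} : T.Adj p q → T.Adj (g • p) (g • q)
  even_dist_smul (g : G) (p : V) : Even (T.dist p (g • p))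
  eq_one_of_fixed {g : G} {p q r : V} : T.Adj p q → T.Adj p r → q ≠ r → g • p = p → g • q = q →
    g • r = r → g = 1
  fixed_of_zpow_fixed {g : G} {p q : V} {n : ℤ} : T.Adj p q → n ≠ 0 → g ^ n • p = p →
    g ^ n • q = q → g • p = p ∧ g • q = q
  exists_notMem_zpowers (p : V) (z : G) : ∃ g : G, g • p = p ∧ g ∉ Subgroup.zpowers z
  exists_smul_ne (p : V) : ∃ g : G, g • p ≠ p

namespace IsMalnormalTreeAction

variable {G : Type*} [Group G] {V : Type*} [MulAction G V] {T : SimpleGraph V}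

theorem dist_smul (hT : IsMalnormalTreeAction G T) (g : G) (p q : V) :
    T.dist (g • p) (g • q) = T.dist p q := by
  have key (g : G) (p q : V) : T.dist (g • p) (g • q) ≤ T.dist p q := by
    obtain ⟨w, hw⟩ := hT.isTree.connected.exists_walk_length_eq_dist p q
    let f : T →g T := ⟨(g • ·), hT.adj_smul g⟩
    rw [← hw, ← w.length_map f]
    exact dist_le (w.map f)
  refine (key g p q).antisymm ?_
  simpa using key g⁻¹ (g • p) (g • q)

theorem dist_smul_left (hT : IsMalnormalTreeAction G T) (g : G) (p q : V) :
    T.dist (g • p) q = T.dist p (g⁻¹ • q) := by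
  rw [← hT.dist_smul g p, smul_inv_smul]

end IsMalnormalTreeAction

/-- The displacement of the vertex `v` by `g`. -/
noncomputable def SimpleGraph.disp {G : Type*} [Group G] {V : Type*} [MulAction G V]
    (T : SimpleGraph V) (v : V) (g : G) : ℕ :=
  T.dist v (g • v)

namespace IsMalnormalTreeAction

variable {G : Type*} [Group G] {V : Type*} [MulAction G V] {T : SimpleGraph V}

theorem dist_smul_smul (hT : IsMalnormalTreeAction G T) (v : V) (g h : G) :
    T.dist (g • v) (h • v) = T.disp v (g⁻¹ * h) := by
  rw [hT.dist_smul_left, disp, mul_smul]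

theorem disp_inv (hT : IsMalnormalTreeAction G T) (v : V) (g : G) :
    T.disp v g⁻¹ = T.disp v g := by
  rw [disp, disp, ← hT.dist_smul_left, dist_comm]

theorem even_disp (hT : IsMalnormalTreeAction G T) (v : V) (g : G) : Even (T.disp v g) :=
  hT.even_dist_smul g v

theorem disp_eq_zero (hT : IsMalnormalTreeAction G T) {v : V} {g : G} :
    T.disp v g = 0 ↔ g • v = v := by
  rw [disp, hT.isTree.connected.dist_eq_zero_iff, eq_comm]

theorem disp_mul_le (hT : IsMalnormalTreeAction G T) (v : V) (g h : G) :
    T.disp v (g * h) ≤ T.disp v g + T.disp v h := by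
  have := hT.isTree.connected.dist_triangle (u := v) (v := g • v) (w := (g * h) • v)
  rwa [hT.dist_smul_smul, inv_mul_cancel_left] at this

theorem disp_mul_fixed (v : V) (g : G) {h : G} (hh : h • v = v) :
    T.disp v (g * h) = T.disp v g := by
  rw [disp, disp, mul_smul, hh]

theorem disp_fixed_mul (hT : IsMalnormalTreeAction G T) (v : V) (g : G) {h : G} (hh : h • v = v) :
    T.disp v (h * g) = T.disp v g := by
  rw [← hT.disp_inv, mul_inv_rev, disp_mul_fixed _ _ (inv_smul_eq_iff.2 hh.symm), hT.disp_inv]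

theorem disp_four_point (hT : IsMalnormalTreeAction G T) (v : V) (f g h : G) :
    T.disp v (f⁻¹ * g) + T.disp v h ≤ T.disp v (f⁻¹ * h) + T.disp v g ∨
      T.disp v (f⁻¹ * g) + T.disp v h ≤ T.disp v (g⁻¹ * h) + T.disp v f := by
  simp only [← hT.dist_smul_smul]
  exact hT.isTree.dist_four_point v (f • v) (g • v) (h • v)

theorem sameDir_smul_iff (hT : IsMalnormalTreeAction G T) (v : V) (g h : G) :
    T.SameDir v (g • v) (h • v) ↔ T.disp v (g⁻¹ * h) + 2 ≤ T.disp v g + T.disp v h := by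
  rw [SameDir, hT.dist_smul_smul, disp, disp, disp]

/-- Nielsen's local-to-global principle: a product of letters in which each letter survives the
cancellation with its two neighbours has large displacement. -/
theorem length_le_disp_prod (hT : IsMalnormalTreeAction G T) {Λ : Type*} (ι : Λ → G)
    (R : Λ → Λ → Prop) (v : V) (hex : ∀ t, ∃ s, R s t)
    (hpair : ∀ s t, R s t → T.disp v (ι s) < T.disp v (ι s * ι t) + T.disp v (ι t))
    (htriple : ∀ s t u, R s t → R t u → T.disp v (ι s) + T.disp v (ι u) <
      T.disp v (ι s * ι t) + T.disp v (ι t * ι u)) {l : List Λ} (hl : l.IsChain R) :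
    l.length ≤ 2 * T.disp v (l.map ι).prod := by
  cases l with
  | nil => simp
  | cons t l =>
  suffices ∀ s, R s t →
      T.disp v (ι s * ((t :: l).map ι).prod) + T.disp v (ι t) =
        T.disp v (ι s * ι t) + T.disp v ((t :: l).map ι).prod ∧
      T.disp v (ι s) + T.disp v (ι t) + (t :: l).length ≤
        2 * T.disp v ((t :: l).map ι).prod + T.disp v (ι s * ι t) by
    obtain ⟨s, hs⟩ := hex t
    have h₁ := (this s hs).2
    have h₂ := hT.disp_mul_le v (ι s) (ι t)
    omega
  induction l generalizing t with
  | nil =>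
    intro s hs
    have := hpair s t hs
    rw [List.map_singleton, List.prod_singleton, List.length_singleton]
    exact ⟨rfl, by omega⟩
  | cons u l ih =>
    intro s hs
    obtain ⟨htu, hl⟩ := List.isChain_cons_cons.1 hl
    obtain ⟨h₁, h₂⟩ := ih u hl t htu
    have h₃ := htriple s t u hs htu
    rw [List.map_cons, List.prod_cons, List.length_cons]
    set w := ((u :: l).map ι).prod
    have h₄ := hT.disp_four_point v (ι s)⁻¹ (ι t) (ι t * w)
    have h₅ := hT.disp_four_point v (ι s)⁻¹ (ι t * w) (ι t)
    rw [inv_inv, inv_mul_cancel_left, hT.disp_inv] at h₄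
    rw [inv_inv, ← hT.disp_inv _ ((ι t * w)⁻¹ * ι t), mul_inv_rev, inv_inv, inv_mul_cancel_left,
      hT.disp_inv] at h₅
    omega

end IsMalnormalTreeAction

/-- Normal forms for a group generated by two elements, with syllables powers of `x` and `y`. -/
theorem exists_zpow_mul_prod_syllables {G : Type*} [Group G] {x y : G}
    (hxy : Subgroup.closure {x, y} = ⊤) (g : G) :
    ∃ (n : ℤ) (l : List ({i : ℤ // i ≠ 0} × ℤ)), l.IsChain (fun s _ => s.2 ≠ 0) ∧
      g = y ^ n * (l.map fun s => x ^ (s.1 : ℤ) * y ^ s.2).prod := by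
  have key (k : ℤ) (g : G) : (∃ (n : ℤ) (l : List ({i : ℤ // i ≠ 0} × ℤ)),
      l.IsChain (fun s _ => s.2 ≠ 0) ∧
        g = y ^ n * (l.map fun s => x ^ (s.1 : ℤ) * y ^ s.2).prod) →
      ∃ (n : ℤ) (l : List ({i : ℤ // i ≠ 0} × ℤ)), l.IsChain (fun s _ => s.2 ≠ 0) ∧
        x ^ k * g = y ^ n * (l.map fun s => x ^ (s.1 : ℤ) * y ^ s.2).prod := by
    rintro ⟨n, l, hl, rfl⟩
    rcases eq_or_ne k 0 with rfl | hk
    · exact ⟨n, l, hl, by simp⟩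
    rcases l with _ | ⟨⟨⟨i, hi⟩, j⟩, l⟩
    · exact ⟨0, [(⟨k, hk⟩, n)], by simp, by simp⟩
    rcases eq_or_ne n 0 with rfl | hn
    · rcases eq_or_ne (k + i) 0 with hki | hki
      · refine ⟨j, l, hl.tail, ?_⟩
        simp [← mul_assoc, ← zpow_add, hki]
      · refine ⟨0, (⟨k + i, hki⟩, j) :: l, ?_, by simp [zpow_add, mul_assoc]⟩
        cases l with
        | nil => simp
        | cons u l => simpa using hl
    · exact ⟨0, (⟨k, hk⟩, n) :: (⟨i, hi⟩, j) :: l, List.isChain_cons_cons.2 ⟨hn, hl⟩,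
        by simp [mul_assoc]⟩
  have hg : g ∈ Subgroup.closure {x, y} := hxy ▸ Subgroup.mem_top g
  induction hg using Subgroup.closure_induction_left with
  | one => exact ⟨0, [], by simp, by simp⟩
  | mul_left z hz g _ ih =>
    rcases hz with rfl | rfl
    · simpa using key 1 g ih
    · obtain ⟨n, l, hl, rfl⟩ := ih
      exact ⟨1 + n, l, hl, by rw [zpow_add, zpow_one, mul_assoc]⟩
  | inv_mul_cancel z hz g _ ih =>
    rcases hz with rfl | rfl
    · simpa using key (-1) g ih
    · obtain ⟨n, l, hl, rfl⟩ := ih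
      exact ⟨-1 + n, l, hl, by rw [zpow_add, zpow_neg_one, mul_assoc]⟩

/-- Normal forms for a group generated by two elements, with letters `x` and `x⁻¹`, each followed
by a power of `y`. -/
theorem exists_zpow_mul_prod_letters {G : Type*} [Group G] {x y : G}
    (hxy : Subgroup.closure {x, y} = ⊤) (g : G) :
    ∃ (n : ℤ) (l : List (ℤˣ × ℤ)), l.IsChain (fun s t => s.1 = t.1 ∨ s.2 ≠ 0) ∧
      g = y ^ n * (l.map fun s => x ^ (s.1 : ℤ) * y ^ s.2).prod := by
  have key (ε : ℤˣ) (g : G) : (∃ (n : ℤ) (l : List (ℤˣ × ℤ)),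
      l.IsChain (fun s t => s.1 = t.1 ∨ s.2 ≠ 0) ∧
        g = y ^ n * (l.map fun s => x ^ (s.1 : ℤ) * y ^ s.2).prod) →
      ∃ (n : ℤ) (l : List (ℤˣ × ℤ)), l.IsChain (fun s t => s.1 = t.1 ∨ s.2 ≠ 0) ∧
        x ^ (ε : ℤ) * g = y ^ n * (l.map fun s => x ^ (s.1 : ℤ) * y ^ s.2).prod := by
    rintro ⟨n, l, hl, rfl⟩
    rcases l with _ | ⟨⟨ε', j⟩, l⟩
    · exact ⟨0, [(ε, n)], by simp, by simp⟩
    by_cases h : ε = ε' ∨ n ≠ 0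
    · exact ⟨0, (ε, n) :: (ε', j) :: l, List.isChain_cons_cons.2 ⟨h, hl⟩, by simp [mul_assoc]⟩
    · obtain ⟨hε, rfl⟩ : ε ≠ ε' ∧ n = 0 := by simpa [not_or] using h
      obtain rfl := Int.units_ne_iff_eq_neg.1 hε
      exact ⟨j, l, hl.tail, by simp [← mul_assoc]⟩
  have hg : g ∈ Subgroup.closure {x, y} := hxy ▸ Subgroup.mem_top g
  induction hg using Subgroup.closure_induction_left with
  | one => exact ⟨0, [], by simp, by simp⟩
  | mul_left z hz g _ ih =>
    rcases hz with rfl | rfl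
    · simpa using key 1 g ih
    · obtain ⟨n, l, hl, rfl⟩ := ih
      exact ⟨1 + n, l, hl, by rw [zpow_add, zpow_one, mul_assoc]⟩
  | inv_mul_cancel z hz g _ ih =>
    rcases hz with rfl | rfl
    · simpa using key (-1) g ih
    · obtain ⟨n, l, hl, rfl⟩ := ih
      exact ⟨-1 + n, l, hl, by rw [zpow_add, zpow_neg_one, mul_assoc]⟩

/-- Every element of a generated subgroup is a product of generators and their inverses without
cancelling neighbours. -/
theorem exists_reduced_prod {G : Type*} [Group G] {S : Set G} (hS : S⁻¹ = S) {g : G}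
    (hg : g ∈ Subgroup.closure S) :
    ∃ l : List S, l.IsChain (fun s t : S => (s * t : G) ≠ 1) ∧ g = (l.map (↑)).prod := by
  have key (s : S) (g : G) (h : ∃ l : List S, l.IsChain (fun s t : S => (s * t : G) ≠ 1) ∧
      g = (l.map (↑)).prod) : ∃ l : List S, l.IsChain (fun s t : S => (s * t : G) ≠ 1) ∧
      s * g = (l.map (↑)).prod := by
    obtain ⟨_ | ⟨t, l⟩, hl, rfl⟩ := h
    · exact ⟨[s], by simp, by simp⟩
    by_cases h : (s * t : G) = 1
    · exact ⟨l, hl.tail, by simp [← mul_assoc, h]⟩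
    · exact ⟨s :: t :: l, List.isChain_cons_cons.2 ⟨h, hl⟩, by simp⟩
  induction hg using Subgroup.closure_induction_left with
  | one => exact ⟨[], by simp, by simp⟩
  | mul_left z hz g _ ih => exact key ⟨z, hz⟩ g ih
  | inv_mul_cancel z hz g _ ih => exact key ⟨z⁻¹, hS ▸ Set.inv_mem_inv.2 hz⟩ g ih

namespace IsMalnormalTreeAction

variable {G : Type*} [Group G] {V : Type*} [MulAction G V] {T : SimpleGraph V}

theorem smul_eq_of_sameDir_zpow (hT : IsMalnormalTreeAction G T) {v p m : V} {y : G} {j : ℤ}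
    (hy : y • v = v) (hj : j ≠ 0) (h : T.SameDir v p (y ^ j • p)) (hm : T.Adj v m)
    (hmp : T.dist m p + 1 = T.dist v p) : y • m = m := by
  have hyj : y ^ j • v = v := zpow_mem (MulAction.mem_stabilizer_iff.2 hy) j
  have hm' := hT.adj_smul (y ^ j) hm
  rw [hyj] at hm'
  have hmp' : T.dist (y ^ j • m) (y ^ j • p) + 1 = T.dist v (y ^ j • p) := by
    rw [hT.dist_smul, hmp, ← hT.dist_smul (y ^ j) v, hyj]
  have := h.eq hT.isTree hm hmp hm' hmp'
  exact (hT.fixed_of_zpow_fixed hm hj hyj this.symm).2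

theorem sameDir_smul (hT : IsMalnormalTreeAction G T) {v p q : V} {g : G} (hg : g • v = v)
    (h : T.SameDir v p q) : T.SameDir v (g • p) (g • q) := by
  unfold SameDir at *
  have h₁ := hT.dist_smul g v p
  have h₂ := hT.dist_smul g v q
  rw [hg] at h₁ h₂
  rwa [hT.dist_smul, h₁, h₂]

theorem not_forall_smul_eq (hT : IsMalnormalTreeAction G T) {x y : G}
    (hxy : Subgroup.closure {x, y} = ⊤) {v : V} (hx : x • v = v) : y • v ≠ v := by
  intro hy
  obtain ⟨g, hg⟩ := hT.exists_smul_ne v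
  have : Subgroup.closure {x, y} ≤ MulAction.stabilizer G v := by
    rw [Subgroup.closure_le, Set.pair_subset_iff]
    exact ⟨hx, hy⟩
  exact hg (this (hxy ▸ Subgroup.mem_top g))

/-- The group is not generated by two elliptic elements. -/
theorem not_elliptic_elliptic (hT : IsMalnormalTreeAction G T) {x y : G}
    (hxy : Subgroup.closure {x, y} = ⊤) {u v : V} (hx : x • u = u) : y • v ≠ v := by
  intro hy
  induction hn : T.dist u v using Nat.strong_induction_on generalizing u v with
  | _ h ih =>
  have huv : u ≠ v := by
    rintro rfl
    exact hT.not_forall_smul_eq hxy hx hy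
  obtain ⟨m, hm, hmu⟩ := hT.isTree.connected.exists_adj_dist_add_one huv.symm
  obtain ⟨n, hun, hnv⟩ := hT.isTree.connected.exists_adj_dist_add_one huv
  have hym : y • m ≠ m := by
    intro hym
    rw [dist_comm, dist_comm (u := v)] at hmu
    exact ih (T.dist u m) (by omega) hx hym rfl
  have hxn : x • n ≠ n := fun hxn => ih (T.dist n v) (by omega) hxn hy rfl
  have hyj (j : ℤ) : y ^ j • v = v := zpow_mem (MulAction.mem_stabilizer_iff.2 hy) j
  have hxi (i : ℤ) : x ^ i • u = u := zpow_mem (MulAction.mem_stabilizer_iff.2 hx) i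
  have hpos := hT.isTree.connected.pos_dist_of_ne huv
  have hux (i : ℤ) : T.dist u (x ^ i • v) = h := by
    rw [← hn, ← hT.dist_smul (x ^ i) u v, hxi]
  have hLx (i : ℤ) (hi : i ≠ 0) : T.disp v (x ^ i) = 2 * h := by
    have := hT.isTree.dist_eq_of_not_sameDir
      (fun e => hxn (hT.smul_eq_of_sameDir_zpow (p := v) hx hi e hun hnv))
    rw [disp, this, hux]
    omega
  have hdir (i : ℤ) (hi : i ≠ 0) : T.SameDir v u (x ^ i • v) := by
    have := hLx i hi
    rw [disp] at this
    rw [SameDir, hux, dist_comm (u := v), this]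
    omega
  have hL (i j k : ℤ) (hi : i ≠ 0) (hj : j ≠ 0) (hk : k ≠ 0) :
      T.disp v (x ^ i * y ^ j * x ^ k) = 4 * h := by
    have : ¬ T.SameDir v (x ^ (-i) • v) ((y ^ j * x ^ k) • v) := by
      intro e
      rw [mul_smul] at e
      refine hym (hT.smul_eq_of_sameDir_zpow (p := u) hy hj ?_ hm hmu)
      exact ((hdir (-i) (by omega)).trans hT.isTree e).trans hT.isTree
        (hT.sameDir_smul (hyj j) (hdir k hk)).symm
    have := hT.isTree.dist_eq_of_not_sameDir this
    rw [hT.dist_smul_smul, ← disp, ← disp, hT.disp_fixed_mul _ _ (hyj j), hLx _ hk,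
      hLx _ (by omega), zpow_neg, inv_inv, ← mul_assoc] at this
    omega
  have hfin : ∀ g : G, g • v = v → g ∈ Subgroup.zpowers y := by
    intro g hg
    obtain ⟨n, l, hl, rfl⟩ := exists_zpow_mul_prod_syllables hxy g
    have hlen := hT.length_le_disp_prod
      (fun s : {i : ℤ // i ≠ 0} × ℤ => x ^ (s.1 : ℤ) * y ^ s.2) _ v
      (fun t => ⟨(⟨1, by simp⟩, 1), by simp⟩) (fun s t hs => by
        simp only [← mul_assoc]
        rw [disp_mul_fixed _ _ (hyj _), disp_mul_fixed _ _ (hyj _), disp_mul_fixed _ _ (hyj _),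
          hLx _ s.1.2, hLx _ t.1.2, hL _ _ _ s.1.2 hs t.1.2]
        omega) (fun s t u hs ht => by
        simp only [← mul_assoc]
        rw [disp_mul_fixed _ _ (hyj _), disp_mul_fixed _ _ (hyj _), disp_mul_fixed _ _ (hyj _),
          disp_mul_fixed _ _ (hyj _), hLx _ s.1.2, hLx _ u.1.2, hL _ _ _ s.1.2 hs t.1.2,
          hL _ _ _ t.1.2 ht u.1.2]
        omega) hl
    rw [← hT.disp_fixed_mul v _ (hyj n), hT.disp_eq_zero.2 hg] at hlen
    obtain rfl : l = [] := by simpa using hlen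
    simp
  obtain ⟨g, hg, hg'⟩ := hT.exists_notMem_zpowers v y
  exact hg' (hfin g hg)

end IsMalnormalTreeAction

theorem Subgroup.closure_pair_eq_top {G : Type*} [Group G] {x y x' y' : G}
    (h : closure {x, y} = ⊤) (hx : x ∈ closure {x', y'}) (hy : y ∈ closure {x', y'}) :
    closure {x', y'} = ⊤ :=
  top_le_iff.1 (h ▸ (closure_le _).2 (Set.pair_subset hx hy))

theorem Subgroup.closure_mul_zpow_pair {G : Type*} [Group G] {x y : G}
    (h : closure {x, y} = ⊤) (n : ℤ) : closure {x * y ^ n, y} = ⊤ := by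
  have hx : x * y ^ n ∈ closure {x * y ^ n, y} := subset_closure (by simp)
  have hy : y ∈ closure {x * y ^ n, y} := subset_closure (by simp)
  exact closure_pair_eq_top h (by simpa using mul_mem hx (inv_mem (zpow_mem hy n))) hy

namespace IsMalnormalTreeAction

variable {G : Type*} [Group G] {V : Type*} [MulAction G V] {T : SimpleGraph V}

/-- An element displacing a vertex at least as much as its square does is elliptic. -/
theorem exists_smul_eq_of_disp_mul_self_le (hT : IsMalnormalTreeAction G T) {x : G} {v : V}
    (h : T.disp v (x * x) ≤ T.disp v x) : ∃ m : V, x • m = m := by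
  obtain ⟨r, hr⟩ := hT.even_disp v x
  obtain ⟨m, h₁, h₂⟩ := hT.isTree.exists_dist_eq v (x • v) (r := r) (by rw [← disp]; omega)
  have hinv := hT.disp_inv v x
  have h₃ : T.dist v (x⁻¹ • m) = r := by
    rw [dist_comm, ← inv_inv x, hT.dist_smul_left, inv_inv, inv_inv]
    rw [← disp] at h₂
    omega
  have h₄ : T.dist (x⁻¹ • m) (x⁻¹ • v) + r = T.dist v (x⁻¹ • v) := by
    rw [hT.dist_smul, dist_comm, h₁, ← disp, hinv, hr]
  have := hT.isTree.eq_of_dist_eq h₁ h₂ h₃ h₄ (by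
    rw [hT.dist_smul_smul, ← disp, ← disp, hinv, ← mul_inv_rev, hT.disp_inv]
    omega)
  exact ⟨m, eq_inv_smul_iff.1 this⟩

/-- Moving a vertex towards the axis or fixed point set of `x` reduces its displacement. -/
theorem disp_add_two_le_of_sameDir (hT : IsMalnormalTreeAction G T) {x : G} {v m : V}
    (h : T.SameDir v (x • v) (x⁻¹ • v)) (hm : T.Adj v m)
    (hmx : T.dist m (x • v) + 1 = T.dist v (x • v)) : T.disp m x + 2 ≤ T.disp v x := by
  have h₁ := h.dist_add_one hT.isTree hm hmx
  have h₂ := hT.isTree.dist_four_point v m (x • m) (x • v)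
  rw [hT.dist_smul, dist_comm (u := m) (v := v), dist_eq_one_iff_adj.2 hm, dist_comm (u := v)
    (v := x • m), hT.dist_smul_left] at h₂
  rw [← disp, hT.disp_inv] at h₁
  rw [← disp] at h₂ hmx
  obtain ⟨r, hr⟩ := hT.even_disp v x
  rw [← disp] at h₂
  omega

theorem two_mul_dist_le (hT : IsMalnormalTreeAction G T) {y : G} {v : V} {j : ℤ}
    (hy : y • v = v) (hy₁ : y ≠ 1) (hj : j ≠ 0) (p : V) :
    2 * T.dist v p ≤ T.dist p (y ^ j • p) + 2 := by
  by_contra! h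
  have hyj : y ^ j • v = v := zpow_mem (MulAction.mem_stabilizer_iff.2 hy) j
  have hyp := hT.dist_smul (y ^ j) v p
  rw [hyj] at hyp
  have heven := hT.isTree.even_dist v p (y ^ j • p)
  have h' : T.dist p (y ^ j • p) + 2 * 2 ≤ T.dist v p + T.dist v (y ^ j • p) := by grind
  have htri := hT.isTree.connected.dist_triangle (u := v) (v := p) (w := y ^ j • p)
  obtain ⟨m, hm, hmp⟩ := hT.isTree.connected.exists_adj_dist_add_one (p := v) (q := p)
    (by rintro rfl; simp at h)
  obtain ⟨k, hk, hkp⟩ := hT.isTree.connected.exists_adj_dist_add_one (p := m) (q := p)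
    (by rintro rfl; simp at hmp; omega)
  have h₁ := dist_eq_one_iff_adj.2 hm
  have h₂ := dist_eq_one_iff_adj.2 hk
  have h₃ : T.dist v k = 2 := by
    have := hT.isTree.connected.dist_triangle (u := v) (v := m) (w := k)
    have := hT.isTree.connected.dist_triangle (u := v) (v := k) (w := p)
    omega
  have key {r : ℕ} (hr : r ≤ 2) {n : V} (hn : T.dist v n = r)
      (hn' : T.dist n p + r = T.dist v p) : y ^ j • n = n := by
    refine (hT.isTree.eq_of_dist_eq hn hn' (q := y ^ j • p) ?_ ?_ (by omega)).symm
    · have := hT.dist_smul (y ^ j) v n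
      rw [hyj] at this
      rw [this, hn]
    · rw [hT.dist_smul, hn', hyp]
  have hym := key (by omega) h₁ hmp
  have hyk := key le_rfl h₃ (by omega)
  refine hy₁ (hT.eq_one_of_fixed hm.symm hk (by rintro rfl; simp at h₃)
    (hT.fixed_of_zpow_fixed hm hj hyj hym).2 hy (hT.fixed_of_zpow_fixed hk hj hym hyk).2)

/-- The vertex stabiliser is computed by ping-pong, contradicting that it is not cyclic. -/
theorem exists_disp_add_disp_le (hT : IsMalnormalTreeAction G T) {x y : G}
    (hxy : Subgroup.closure {x, y} = ⊤) {v : V} (hy : y • v = v) :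
    ∃ (ε₁ ε₂ ε₃ : ℤˣ) (i j : ℤ), (ε₁ = ε₂ ∨ i ≠ 0) ∧ (ε₂ = ε₃ ∨ j ≠ 0) ∧
      T.disp v (x ^ (ε₁ : ℤ) * y ^ i * x ^ (ε₂ : ℤ)) +
        T.disp v (x ^ (ε₂ : ℤ) * y ^ j * x ^ (ε₃ : ℤ)) ≤ 2 * T.disp v x := by
  by_contra! H
  have hyj (j : ℤ) : y ^ j • v = v := zpow_mem (MulAction.mem_stabilizer_iff.2 hy) j
  have hLx (ε : ℤˣ) : T.disp v (x ^ (ε : ℤ)) = T.disp v x := by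
    rcases Int.units_eq_one_or ε with rfl | rfl <;> simp [hT.disp_inv]
  obtain ⟨g, hg, hg'⟩ := hT.exists_notMem_zpowers v y
  obtain ⟨n, l, hl, rfl⟩ := exists_zpow_mul_prod_letters hxy g
  have hlen := hT.length_le_disp_prod (fun s : ℤˣ × ℤ => x ^ (s.1 : ℤ) * y ^ s.2) _ v
    (fun t => ⟨t, Or.inl rfl⟩) (fun s t hs => by
      simp only [← mul_assoc]
      rw [disp_mul_fixed _ _ (hyj _), disp_mul_fixed _ _ (hyj _), disp_mul_fixed _ _ (hyj _),
        hLx, hLx]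
      have h₁ := H s.1 t.1 t.1 s.2 0 hs (Or.inl rfl)
      have h₂ := hT.disp_mul_le v (x ^ (t.1 : ℤ) * y ^ (0 : ℤ)) (x ^ (t.1 : ℤ))
      rw [disp_mul_fixed _ _ (hyj _), hLx] at h₂
      omega) (fun s t u hs ht => by
      simp only [← mul_assoc]
      rw [disp_mul_fixed _ _ (hyj _), disp_mul_fixed _ _ (hyj _), disp_mul_fixed _ _ (hyj _),
        disp_mul_fixed _ _ (hyj _), hLx, hLx]
      have := H _ _ _ _ _ hs ht
      omega) hl
  rw [← hT.disp_fixed_mul v _ (hyj n), hT.disp_eq_zero.2 hg] at hlen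
  obtain rfl : l = [] := by simpa using hlen
  exact hg' (by simp)

/-- The case of a hyperbolic and an elliptic generator where the axis of the former avoids a
vertex fixed by the latter. -/
theorem not_sameDir_of_minimal (hT : IsMalnormalTreeAction G T) {x y : G}
    (hxy : Subgroup.closure {x, y} = ⊤) {v : V} (hy : y • v = v)
    (hmin : ∀ u : V, y • u = u → T.disp v x ≤ T.disp u x) :
    ¬ T.SameDir v (x • v) (x⁻¹ • v) := by
  intro h
  have hyj (j : ℤ) : y ^ j • v = v := zpow_mem (MulAction.mem_stabilizer_iff.2 hy) j
  have hx : T.disp v x < T.disp v (x * x) := by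
    by_contra! hle
    obtain ⟨u, hu⟩ := hT.exists_smul_eq_of_disp_mul_self_le hle
    exact hT.not_elliptic_elliptic hxy hu hy
  have hv : v ≠ x • v := h.ne
  have hpos := hT.isTree.connected.pos_dist_of_ne hv
  obtain ⟨m, hm, hmx⟩ := hT.isTree.connected.exists_adj_dist_add_one hv
  have hdir (ε : ℤˣ) : T.SameDir v (x • v) (x ^ (ε : ℤ) • v) := by
    rcases Int.units_eq_one_or ε with rfl | rfl
    · simp only [SameDir, Units.val_one, zpow_one, dist_self]
      omega
    · simpa using h
  have hLx (ε : ℤˣ) : T.disp v (x ^ (ε : ℤ)) = T.disp v x := by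
    rcases Int.units_eq_one_or ε with rfl | rfl <;> simp [hT.disp_inv]
  have key (ε δ : ℤˣ) (j : ℤ) (hj : ε = δ ∨ j ≠ 0) :
      T.disp v x < T.disp v (x ^ (ε : ℤ) * y ^ j * x ^ (δ : ℤ)) := by
    rcases eq_or_ne j 0 with rfl | hj₀
    · obtain rfl : ε = δ := by simpa using hj
      rcases Int.units_eq_one_or ε with rfl | rfl
      · simpa using hx
      · simpa [← mul_inv_rev, hT.disp_inv] using hx
    have hnot : ¬ T.SameDir v (x ^ ((-ε : ℤˣ) : ℤ) • v) ((y ^ j * x ^ (δ : ℤ)) • v) := by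
      intro e
      rw [mul_smul] at e
      have hym := hT.smul_eq_of_sameDir_zpow (p := x • v) hy hj₀
        (((hdir (-ε)).trans hT.isTree e).trans hT.isTree
          (hT.sameDir_smul (hyj j) (hdir δ)).symm) hm hmx
      have h₁ := hmin m hym
      have h₂ := hT.disp_add_two_le_of_sameDir h hm hmx
      omega
    have := hT.isTree.dist_eq_of_not_sameDir hnot
    rw [hT.dist_smul_smul, ← disp, ← disp, hT.disp_fixed_mul _ _ (hyj j), hLx, hLx,
      Units.val_neg, zpow_neg, inv_inv, ← mul_assoc] at this
    have : 0 < T.disp v x := hpos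
    omega
  obtain ⟨ε₁, ε₂, ε₃, i, j, hi, hj, hle⟩ := hT.exists_disp_add_disp_le hxy hy
  have h₁ := key _ _ _ hi
  have h₂ := key _ _ _ hj
  omega

/-- No generating pair contains an elliptic element. -/
theorem smul_ne_of_closure_pair (hT : IsMalnormalTreeAction G T) {x y : G}
    (hxy : Subgroup.closure {x, y} = ⊤) (v : V) : y • v ≠ v := by
  intro hy
  induction hn : T.disp v x using Nat.strong_induction_on generalizing x v with
  | _ a ih =>
  have hmin {x' : G} (hxy' : Subgroup.closure {x', y} = ⊤) (hx' : T.disp v x' = a) (u : V)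
      (hu : y • u = u) : T.disp v x' ≤ T.disp u x' := by
    by_contra! hlt
    exact ih _ (hx' ▸ hlt) hxy' u hu rfl
  have hyj (j : ℤ) : y ^ j • v = v := zpow_mem (MulAction.mem_stabilizer_iff.2 hy) j
  have hnot (n : ℤ) : ¬ T.SameDir v (x⁻¹ • v) ((y ^ n * x) • v) := by
    intro h
    refine hT.not_sameDir_of_minimal (Subgroup.closure_mul_zpow_pair hxy n) hy
      (hmin (Subgroup.closure_mul_zpow_pair hxy n) ((disp_mul_fixed _ _ (hyj n)).trans hn)) ?_
    have := hT.sameDir_smul (hyj (-n)) h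
    rw [← mul_smul, ← mul_smul, zpow_neg, inv_mul_cancel_left, ← mul_inv_rev] at this
    rw [mul_smul x, hyj]
    exact this.symm
  have hy₁ : y ≠ 1 := by
    rintro rfl
    obtain ⟨g, -, hg⟩ := hT.exists_notMem_zpowers v x
    have : Subgroup.zpowers x = ⊤ := top_le_iff.1 (hxy ▸ (Subgroup.closure_le _).2
      (Set.pair_subset (Subgroup.mem_zpowers x) (one_mem _)))
    exact hg (this ▸ Subgroup.mem_top g)
  have ha : 2 ≤ a := by
    have h₁ : T.disp v x ≠ 0 := fun h =>
      hT.not_forall_smul_eq hxy (hT.disp_eq_zero.1 h) hy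
    obtain ⟨r, hr⟩ := hT.even_disp v x
    omega
  have hsame (ε : ℤˣ) (j : ℤ) : T.disp v (x ^ (ε : ℤ) * y ^ j * x ^ (ε : ℤ)) = 2 * a := by
    have key (j : ℤ) : T.disp v (x * y ^ j * x) = 2 * a := by
      have := hT.isTree.dist_eq_of_not_sameDir (hnot j)
      rw [hT.dist_smul_smul, ← disp, ← disp, inv_inv, ← mul_assoc, hT.disp_inv,
        hT.disp_fixed_mul _ _ (hyj j)] at this
      omega
    rcases Int.units_eq_one_or ε with rfl | rfl
    · simpa using key j
    · have := key (-j)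
      rw [← hT.disp_inv] at this
      simpa [mul_assoc] using this
  have hge (g : G) (j : ℤ) (hj : j ≠ 0) :
      2 * T.disp v g ≤ T.disp v (g⁻¹ * y ^ j * g) + 2 := by
    have := hT.two_mul_dist_le hy hy₁ hj (g • v)
    rwa [← mul_smul, hT.dist_smul_smul, ← mul_assoc] at this
  have hfix (g : G) (m : V) (hm : T.Adj v m) (hmg : T.dist m (g • v) + 1 = T.dist v (g • v))
      (hym : y • m ≠ m) (j : ℤ) (hj : j ≠ 0) :
      T.disp v (g⁻¹ * y ^ j * g) = 2 * T.disp v g := by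
    have := hT.isTree.dist_eq_of_not_sameDir
      (fun e => hym (hT.smul_eq_of_sameDir_zpow (p := g • v) hy hj e hm hmg))
    rw [← mul_smul, hT.dist_smul_smul, ← disp, ← disp, hT.disp_fixed_mul _ _ (hyj j),
      ← mul_assoc] at this
    omega
  have hdich : (∀ j : ℤ, j ≠ 0 → T.disp v (x⁻¹ * y ^ j * x) = 2 * a) ∨
      (∀ j : ℤ, j ≠ 0 → T.disp v (x * y ^ j * x⁻¹) = 2 * a) := by
    have hinv := hT.disp_inv v x
    obtain ⟨m, hm, hmx⟩ := hT.isTree.connected.exists_adj_dist_add_one (p := v) (q := x • v)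
      fun h => hT.not_forall_smul_eq hxy h.symm hy
    obtain ⟨n, hn', hnx⟩ := hT.isTree.connected.exists_adj_dist_add_one (p := v) (q := x⁻¹ • v)
      fun h => hT.not_forall_smul_eq hxy (eq_inv_smul_iff.1 h) hy
    by_cases hym : y • m = m
    · by_cases hyn : y • n = n
      · rcases eq_or_ne m n with rfl | hmn
        · refine absurd ?_ (hnot 0)
          have := hT.isTree.connected.dist_triangle (u := x⁻¹ • v) (v := m) (w := x • v)
          rw [dist_comm (u := x⁻¹ • v) (v := m)] at this
          rw [zpow_zero, one_mul, SameDir]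
          omega
        · exact absurd (hT.eq_one_of_fixed hm hn' hmn hy hym hyn) hy₁
      · right
        intro j hj
        have := hfix x⁻¹ n hn' hnx hyn j hj
        rwa [inv_inv, hinv, hn] at this
    · left
      intro j hj
      rw [hfix x m hm hmx hym j hj, hn]
  have hge₁ (j : ℤ) (hj : j ≠ 0) := hge x j hj
  have hge₂ (j : ℤ) (hj : j ≠ 0) := hge x⁻¹ j hj
  simp only [inv_inv, hT.disp_inv v x, hn] at hge₁ hge₂
  obtain ⟨ε₁, ε₂, ε₃, i, j, hi, hj, hle⟩ := hT.exists_disp_add_disp_le hxy hy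
  have h₁ := hsame ε₁ i
  have h₂ := hsame ε₂ j
  rw [hn] at hle
  have hne : (1 : ℤˣ) ≠ -1 := by decide
  clear ih hmin hyj hnot hy₁ hsame hge hfix
  rcases Int.units_eq_one_or ε₁ with rfl | rfl <;> rcases Int.units_eq_one_or ε₂ with rfl | rfl <;>
    rcases Int.units_eq_one_or ε₃ with rfl | rfl <;>
    simp only [Units.val_one, Units.val_neg, zpow_one, zpow_neg, hne, hne.symm, true_or,
      false_or] at * <;>
    grind

end IsMalnormalTreeAction

/-- A generating pair and a vertex with minimal total displacement. -/
def SimpleGraph.IsShortestPair {G : Type*} [Group G] {V : Type*} [MulAction G V]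
    (T : SimpleGraph V) (v : V) (x y : G) : Prop :=
  Subgroup.closure {x, y} = ⊤ ∧ ∀ (x' y' : G) (u : V), Subgroup.closure {x', y'} = ⊤ →
    T.disp v x + T.disp v y ≤ T.disp u x' + T.disp u y'

namespace SimpleGraph.IsShortestPair

variable {G : Type*} [Group G] {V : Type*} [MulAction G V] {T : SimpleGraph V} {v : V} {x y : G}

theorem symm (h : T.IsShortestPair v x y) : T.IsShortestPair v y x :=
  ⟨Set.pair_comm x y ▸ h.1, fun x' y' u h' => (add_comm _ _).trans_le (h.2 x' y' u h')⟩

theorem of_disp_le (h : T.IsShortestPair v x y) {x' : G} (hx : x ∈ Subgroup.closure {x', y})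
    (h' : T.disp v x' ≤ T.disp v x) : T.IsShortestPair v x' y :=
  ⟨Subgroup.closure_pair_eq_top h.1 hx (Subgroup.subset_closure (by simp)),
    fun x'' y'' u h'' => by have := h.2 x'' y'' u h''; omega⟩

theorem inv_left (hT : IsMalnormalTreeAction G T) (h : T.IsShortestPair v x y) :
    T.IsShortestPair v x⁻¹ y :=
  h.of_disp_le (inv_mem_iff.1 (Subgroup.subset_closure (by simp))) (hT.disp_inv v x).le

theorem inv_right (hT : IsMalnormalTreeAction G T) (h : T.IsShortestPair v x y) :
    T.IsShortestPair v x y⁻¹ :=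
  (h.symm.inv_left hT).symm

theorem mem_closure_mul_pair : x ∈ Subgroup.closure {x * y, y} := by
  have h : x * y ∈ Subgroup.closure {x * y, y} := Subgroup.subset_closure (by simp)
  simpa using mul_mem h (inv_mem (Subgroup.subset_closure (by simp : y ∈ {x * y, y})))

theorem disp_le_disp_mul (h : T.IsShortestPair v x y) : T.disp v x ≤ T.disp v (x * y) := by
  have := h.2 (x * y) y v (Subgroup.closure_pair_eq_top h.1 mem_closure_mul_pair
    (Subgroup.subset_closure (by simp)))
  omega

theorem disp_le_disp_mul' (hT : IsMalnormalTreeAction G T) (h : T.IsShortestPair v x y) :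
    T.disp v y ≤ T.disp v (x * y) := by
  have := ((h.inv_left hT).symm.inv_left hT).disp_le_disp_mul
  rwa [← mul_inv_rev, hT.disp_inv, hT.disp_inv] at this

theorem disp_pos (hT : IsMalnormalTreeAction G T) (h : T.IsShortestPair v x y) :
    0 < T.disp v x :=
  Nat.pos_of_ne_zero fun h₀ => hT.smul_ne_of_closure_pair h.symm.1 v (hT.disp_eq_zero.1 h₀)

theorem two_le_disp (hT : IsMalnormalTreeAction G T) (h : T.IsShortestPair v x y) :
    2 ≤ T.disp v x := by
  have h₁ := h.disp_pos hT
  obtain ⟨r, hr⟩ := hT.even_disp v x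
  omega

theorem disp_lt_disp_mul_self (hT : IsMalnormalTreeAction G T) (h : T.IsShortestPair v x y) :
    T.disp v x < T.disp v (x * x) := by
  by_contra! hle
  obtain ⟨u, hu⟩ := hT.exists_smul_eq_of_disp_mul_self_le hle
  exact hT.smul_ne_of_closure_pair h.symm.1 u hu

theorem not_sameDir (hT : IsMalnormalTreeAction G T) (h : T.IsShortestPair v x y)
    (hx : T.SameDir v (x • v) (x⁻¹ • v)) : ¬ T.SameDir v (x • v) (y • v) := by
  intro hxy
  obtain ⟨m, hm, hmx⟩ := hT.isTree.connected.exists_adj_dist_add_one hx.ne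
  have h₁ := hT.disp_add_two_le_of_sameDir hx hm hmx
  have h₂ := hxy.dist_add_one hT.isTree hm hmx
  have h₃ := hT.isTree.connected.dist_triangle (u := m) (v := y • v) (w := y • m)
  rw [hT.dist_smul, dist_eq_one_iff_adj.2 hm, h₂, ← disp, ← disp] at h₃
  have h₄ := h.2 x y m h.1
  omega

theorem disp_add_disp_lt_of_eq (hT : IsMalnormalTreeAction G T) (h : T.IsShortestPair v x y) :
    T.disp v x + T.disp v x < T.disp v (x * y) + T.disp v (y * x) := by
  have h₁ := h.disp_le_disp_mul
  have h₂ := h.symm.disp_le_disp_mul' hT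
  by_contra! hle
  have hz := h.of_disp_le mem_closure_mul_pair (by omega)
  have h₃ := h.two_le_disp hT
  have h₄ := h.symm.two_le_disp hT
  have h₅ := h.disp_le_disp_mul' hT
  have d₁ : T.SameDir v ((x * y)⁻¹ • v) (y⁻¹ • v) := by
    rw [hT.sameDir_smul_iff, inv_inv, mul_inv_cancel_right, hT.disp_inv, hT.disp_inv]
    omega
  have d₂ : T.SameDir v (x • v) (y⁻¹ • v) := by
    rw [hT.sameDir_smul_iff, ← mul_inv_rev, hT.disp_inv, hT.disp_inv]
    omega
  have d₃ : T.SameDir v (x • v) ((x * y) • v) := by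
    rw [hT.sameDir_smul_iff, inv_mul_cancel_left]
    omega
  have d₄ := d₃.symm.trans hT.isTree d₂
  exact (hz.inv_right hT).not_sameDir hT (d₄.trans hT.isTree d₁.symm) d₄

theorem disp_add_disp_lt_of_inv (hT : IsMalnormalTreeAction G T) (h : T.IsShortestPair v x y) :
    T.disp v x + T.disp v x < T.disp v (x * y) + T.disp v (y * x⁻¹) := by
  have h₁ := h.disp_le_disp_mul
  have h₂ := (h.symm.inv_right hT).disp_le_disp_mul' hT
  have h₃ := h.symm.two_le_disp hT
  rw [hT.disp_inv] at h₂
  by_contra! hle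
  have d₁ : T.SameDir v (y • v) (x⁻¹ • v) := by
    rw [hT.sameDir_smul_iff, ← mul_inv_rev, hT.disp_inv, hT.disp_inv]
    omega
  have d₂ : T.SameDir v (y⁻¹ • v) (x⁻¹ • v) := by
    rw [hT.sameDir_smul_iff, inv_inv, hT.disp_inv, hT.disp_inv]
    omega
  exact (h.symm.inv_right hT).not_sameDir hT (d₁.trans hT.isTree d₂.symm) d₁

end SimpleGraph.IsShortestPair

namespace IsMalnormalTreeAction

variable {G : Type*} [Group G] {V : Type*} [MulAction G V] {T : SimpleGraph V}

theorem exists_isShortestPair (hT : IsMalnormalTreeAction G T) {x y : G}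
    (hxy : Subgroup.closure {x, y} = ⊤) : ∃ (v : V) (x y : G), T.IsShortestPair v x y := by
  have := hT.isTree.connected.nonempty
  let S := {p : V × G × G // Subgroup.closure {p.2.1, p.2.2} = ⊤}
  have : Nonempty S := ⟨⟨(Classical.arbitrary V, x, y), hxy⟩⟩
  obtain ⟨⟨p, hp⟩, hmin⟩ := exists_minimalFor_of_wellFoundedLT (fun _ : S => True)
    (fun p => T.disp p.1.1 p.1.2.1 + T.disp p.1.1 p.1.2.2) ⟨Classical.arbitrary S, trivial⟩
  refine ⟨p.1, p.2.1, p.2.2, hp, fun x' y' u h => ?_⟩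
  by_contra! hlt
  exact hlt.not_ge (hmin.2 (j := ⟨(u, x', y'), h⟩) trivial hlt.le)

/-- A group acting as in `IsMalnormalTreeAction` is not generated by two elements. -/
theorem closure_pair_ne_top (hT : IsMalnormalTreeAction G T) (x y : G) :
    Subgroup.closure {x, y} ≠ ⊤ := by
  intro hxy
  obtain ⟨v, x, y, h⟩ := hT.exists_isShortestPair hxy
  clear hxy
  let S : Set G := {x, x⁻¹, y, y⁻¹}
  have hS : S⁻¹ = S := by
    ext g
    simp only [S, Set.mem_inv, Set.mem_insert_iff, Set.mem_singleton_iff, inv_eq_iff_eq_inv,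
      inv_inv]
    tauto
  have hmem {s : G} : s ∈ S → s = x ∨ s = x⁻¹ ∨ s = y ∨ s = y⁻¹ := id
  have hshort {s t : G} (hs : s ∈ S) (ht : t ∈ S) (hst : s ≠ t) (hst' : s * t ≠ 1) :
      T.IsShortestPair v s t := by
    have h₁ := h.inv_left hT
    have h₂ := h.inv_right hT
    have h₃ := h₁.inv_right hT
    rcases hmem hs with rfl | rfl | rfl | rfl <;> rcases hmem ht with rfl | rfl | rfl | rfl <;>
      simp at hst hst' <;>
      first | assumption | exact h.symm | exact h₁.symm | exact h₂.symm | exact h₃.symm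
  have hself {s : G} (hs : s ∈ S) : T.disp v s < T.disp v (s * s) := by
    have h₁ := h.disp_lt_disp_mul_self hT
    have h₂ := (h.inv_left hT).disp_lt_disp_mul_self hT
    have h₃ := h.symm.disp_lt_disp_mul_self hT
    have h₄ := (h.symm.inv_left hT).disp_lt_disp_mul_self hT
    rcases hmem hs with rfl | rfl | rfl | rfl <;> assumption
  have hthird {s t u : G} (hs : s ∈ S) (ht : t ∈ S) (hu : u ∈ S) (hst : s ≠ t)
      (hst' : s * t ≠ 1) (htu : t ≠ u) (htu' : t * u ≠ 1) : u = s ∨ u = s⁻¹ := by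
    rcases hmem hs with rfl | rfl | rfl | rfl <;> rcases hmem ht with rfl | rfl | rfl | rfl <;>
      rcases hmem hu with rfl | rfl | rfl | rfl <;> simp at hst hst' htu htu' ⊢
  obtain ⟨c, hc, hc₁⟩ := hT.exists_notMem_zpowers v 1
  have hS' : Subgroup.closure S = ⊤ :=
    top_le_iff.1 (h.1 ▸ Subgroup.closure_mono (Set.pair_subset (by simp [S]) (by simp [S])))
  obtain ⟨l, hl, rfl⟩ := exists_reduced_prod hS (hS' ▸ Subgroup.mem_top c)
  have hlen := hT.length_le_disp_prod (fun s : S => (s : G)) (fun s t => (s * t : G) ≠ 1) v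
    (fun t => ⟨t, fun h₁ => by
      have := hself t.2
      rw [h₁, hT.disp_eq_zero.2 (one_smul G v)] at this
      omega⟩)
    (fun s t hst => by
      by_cases h₁ : (s : G) = t
      · have := hself t.2
        rw [h₁]
        omega
      · have h₂ := hshort s.2 t.2 h₁ hst
        have h₃ := h₂.disp_le_disp_mul
        have h₄ := h₂.symm.disp_pos hT
        omega)
    (fun s t u hst htu => by
      by_cases h₁ : (s : G) = t <;> by_cases h₂ : (t : G) = u
      · have := hself t.2
        rw [h₁, ← h₂]
        omega
      · have h₃ := hself t.2
        have h₄ := (hshort t.2 u.2 h₂ htu).disp_le_disp_mul' hT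
        rw [h₁]
        omega
      · have h₃ := hself t.2
        have h₄ := (hshort s.2 t.2 h₁ hst).disp_le_disp_mul
        rw [← h₂]
        omega
      · have h₃ := hshort s.2 t.2 h₁ hst
        rcases hthird s.2 t.2 u.2 h₁ hst h₂ htu with h₄ | h₄ <;> rw [h₄]
        · exact h₃.disp_add_disp_lt_of_eq hT
        · rw [hT.disp_inv]
          exact h₃.disp_add_disp_lt_of_inv hT) hl
  rw [hT.disp_eq_zero.2 hc] at hlen
  obtain rfl : l = [] := by simpa using hlen
  exact hc₁ (by simp)

end IsMalnormalTreeAction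

section BassSerre

variable {G : Type*} [Group G] {A B : Subgroup G}

theorem mem_inf_of_mem_amalgFam {b : Bool} {x : G} (h : x ∈ amalgFam A B b)
    (h' : x ∈ amalgFam A B !b) : x ∈ A ⊓ B := by
  cases b
  · exact ⟨h', h⟩
  · exact ⟨h, h'⟩

variable (A B) in
/-- `IsAlternating A B b i x` says that `x` is a product of elements outside `A ⊓ B` taken
alternately from the two factors, starting with the factor `b` and such that the factor `i` would
be next. -/
inductive IsAlternating (b : Bool) : Bool → G → Prop
  | one : IsAlternating b b 1
  | mul {i : Bool} {x h : G} : IsAlternating b i x → h ∈ amalgFam A B i → h ∉ A ⊓ B →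
      IsAlternating b (!i) (x * h)

namespace IsAlternating

open Monoid PushoutI CoprodI

theorem exists_word_cons {i : Bool} {x h : G} {w : Word fun j => amalgFam A B j}
    (hw : Reduced (amalgMaps A B) w) (hi : w.fstIdx ≠ some i)
    (hx : amalgToGroup A B (ofCoprodI w.prod) = x⁻¹) (hh : h ∈ amalgFam A B i) (hC : h ∉ A ⊓ B) :
    ∃ w : Word fun j => amalgFam A B j, Reduced (amalgMaps A B) w ∧ w.fstIdx = some i ∧
      amalgToGroup A B (ofCoprodI w.prod) = (x * h)⁻¹ := by
  have h₁ : (⟨h⁻¹, inv_mem hh⟩ : amalgFam A B i) ≠ 1 := by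
    intro h₁
    have : h⁻¹ = 1 := congrArg Subtype.val h₁
    exact hC (inv_eq_one.1 this ▸ one_mem _)
  refine ⟨.cons ⟨h⁻¹, inv_mem hh⟩ w hi h₁, ?_, Word.fstIdx_cons _ _ _ _, ?_⟩
  · intro g hg
    rcases List.mem_cons.1 hg with rfl | hg
    · rintro ⟨c, hc⟩
      have : (c : G) = h⁻¹ := congrArg Subtype.val hc
      exact hC (inv_mem_iff.1 (this ▸ c.2))
    · exact hw g hg
  · rw [Word.prod_cons, map_mul, map_mul, hx, ofCoprodI_of, mul_inv_rev, amalgToGroup,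
      PushoutI.lift_of]
    rfl

theorem exists_word {b i : Bool} {x : G} (hx : IsAlternating A B b i x) :
    ∃ w : Word fun j => amalgFam A B j, Reduced (amalgMaps A B) w ∧ w.fstIdx ≠ some i ∧
      amalgToGroup A B (ofCoprodI w.prod) = x⁻¹ := by
  induction hx with
  | one => exact ⟨.empty, by simp [Reduced, Word.empty], by simp [Word.fstIdx, Word.empty],
      by simp⟩
  | @mul i x h _ hh hC ih =>
    obtain ⟨w, hw, hi, hwx⟩ := ih
    obtain ⟨w', hw', hi', hwx'⟩ := exists_word_cons hw hi hwx hh hC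
    exact ⟨w', hw', by simp [hi'], hwx'⟩

theorem mul_notMem (hinj : Function.Injective (amalgToGroup A B)) {b i : Bool}
    {x h : G} (hx : IsAlternating A B b i x) (hh : h ∈ amalgFam A B i) (hC : h ∉ A ⊓ B) :
    x * h ∉ A ⊓ B := by
  intro hmem
  obtain ⟨w, hw, hi, hwx⟩ := hx.exists_word
  obtain ⟨w, hw, hi, hwx⟩ := exists_word_cons hw hi hwx hh hC
  have hφ (j : Bool) : Function.Injective (amalgMaps A B j) := Subgroup.inclusion_injective _
  have := hw.eq_empty_of_mem_range hφ
    ⟨⟨(x * h)⁻¹, inv_mem hmem⟩, hinj (by rw [hwx, amalgToGroup, PushoutI.lift_base]; rfl)⟩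
  rw [this] at hi
  simp [Word.fstIdx, Word.empty] at hi

end IsAlternating

variable (A B) in
/-- The vertices of the Bass–Serre tree of an amalgam: the cosets of the two factors. -/
abbrev BassSerreVertex : Type _ :=
  Σ b : Bool, G ⧸ amalgFam A B b

namespace BassSerreVertex

variable (A B) in
/-- The coset of `g` as a vertex. -/
def mk (b : Bool) (g : G) : BassSerreVertex A B :=
  ⟨b, (g : G ⧸ amalgFam A B b)⟩

theorem exists_eq_mk (p : BassSerreVertex A B) : ∃ b g, p = mk A B b g := by
  obtain ⟨b, x⟩ := p
  obtain ⟨g, rfl⟩ := QuotientGroup.mk_surjective x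
  exact ⟨b, g, rfl⟩

theorem smul_mk (b : Bool) (g h : G) : g • mk A B b h = mk A B b (g * h) :=
  rfl

theorem mk_inj {b : Bool} {g h : G} : mk A B b g = mk A B b h ↔ g⁻¹ * h ∈ amalgFam A B b := by
  rw [mk, mk, Sigma.mk.injEq, heq_iff_eq, QuotientGroup.eq]
  simp

theorem smul_mk_eq_iff {b : Bool} {g h : G} :
    g • mk A B b h = mk A B b h ↔ h⁻¹ * g * h ∈ amalgFam A B b := by
  rw [smul_mk, eq_comm, mk_inj, mul_assoc]

end BassSerreVertex

open BassSerreVertex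

variable (A B) in
/-- The Bass–Serre tree of an amalgam. -/
def bassSerreTree : SimpleGraph (BassSerreVertex A B) where
  Adj p q := ∃ b g, p = mk A B b g ∧ q = mk A B (!b) g
  symm := by
    constructor
    rintro _ _ ⟨b, g, rfl, rfl⟩
    exact ⟨!b, g, rfl, by rw [Bool.not_not]⟩
  loopless := by
    constructor
    rintro _ ⟨b, g, rfl, h⟩
    exact Bool.not_ne_self b (congrArg Sigma.fst h).symm

theorem bassSerreTree_adj_mk {b : Bool} {g : G} {q : BassSerreVertex A B}
    (h : (bassSerreTree A B).Adj (mk A B b g) q) :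
    ∃ x ∈ amalgFam A B b, q = mk A B (!b) (g * x) := by
  obtain ⟨b', g', h₁, rfl⟩ := h
  obtain rfl : b = b' := congrArg Sigma.fst h₁
  exact ⟨g⁻¹ * g', mk_inj.1 h₁, by rw [mul_inv_cancel_left]⟩

theorem bassSerreTree_adj_smul (g : G) {p q : BassSerreVertex A B}
    (h : (bassSerreTree A B).Adj p q) : (bassSerreTree A B).Adj (g • p) (g • q) := by
  obtain ⟨b, g', rfl, rfl⟩ := h
  exact ⟨b, g * g', rfl, rfl⟩

theorem bassSerreTree_isAcyclic (hinj : Function.Injective (amalgToGroup A B)) :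
    (bassSerreTree A B).IsAcyclic := by
  rw [isAcyclic_iff_forall_adj_isBridge]
  rintro _ _ ⟨b, g, rfl, rfl⟩
  rw [isBridge_iff]
  have key {p q : BassSerreVertex A B}
      (w : ((bassSerreTree A B).deleteEdges {s(mk A B b g, mk A B (!b) g)}).Walk p q) :
      (∃ i x, IsAlternating A B b i x ∧ p = mk A B i (g * x)) →
        ∃ i x, IsAlternating A B b i x ∧ q = mk A B i (g * x) := by
    induction w with
    | nil => exact id
    | cons hadj w ih =>
      rintro ⟨i, x, hx, rfl⟩
      apply ih
      rw [deleteEdges_adj] at hadj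
      obtain ⟨h, hh, rfl⟩ := bassSerreTree_adj_mk hadj.1
      by_cases hC : h ∈ A ⊓ B
      · cases hx with
        | one =>
          refine absurd ?_ hadj.2
          have : mk A B (!b) (g * 1 * h) = mk A B (!b) g := by
            rw [eq_comm, mk_inj]
            simpa using inf_le_amalgFam A B _ hC
          rw [this, mul_one]
          rfl
        | @mul j x k hx hk hkC =>
          refine ⟨j, x, hx, ?_⟩
          rw [Bool.not_not, eq_comm, mk_inj]
          simpa [mul_assoc] using mul_mem hk (inf_le_amalgFam A B j hC)
      · exact ⟨!i, x * h, hx.mul hh hC, by rw [mul_assoc]⟩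
  rintro ⟨w⟩
  obtain ⟨i, x, hx, h⟩ := key w ⟨b, 1, .one, by rw [mul_one]⟩
  obtain rfl : (!b) = i := congrArg Sigma.fst h
  have hxb : x ∈ amalgFam A B !b := by simpa using mk_inj.1 h
  by_cases hC : x ∈ A ⊓ B
  · generalize hi : (!b) = i at hx
    cases hx with
    | one => exact Bool.not_ne_self b hi
    | mul hx hk hkC => exact hx.mul_notMem hinj hk hkC hC
  · exact hx.mul_notMem hinj (inv_mem hxb) (fun h => hC (inv_mem_iff.1 h)) (by simp)

theorem bassSerreTree_connected (hsurj : Function.Surjective (amalgToGroup A B)) :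
    (bassSerreTree A B).Connected := by
  have hadj (b : Bool) (g : G) : (bassSerreTree A B).Adj (mk A B b g) (mk A B (!b) g) :=
    ⟨b, g, rfl, rfl⟩
  have hbase (g : G) (b b' : Bool) :
      (bassSerreTree A B).Reachable (mk A B b g) (mk A B b' g) := by
    rcases eq_or_ne b' b with rfl | h
    · exact .rfl
    · obtain rfl : b' = !b := Bool.eq_not.2 h
      exact (hadj b g).reachable
  have key (x : Monoid.PushoutI (amalgMaps A B)) (g : G) (b : Bool) :
      (bassSerreTree A B).Reachable (mk A B b g) (mk A B b (g * amalgToGroup A B x)) := by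
    induction x using Monoid.PushoutI.induction_on generalizing g b with
    | of i h =>
      have : mk A B i g = mk A B i (g * h) := by
        rw [mk_inj]
        simp
      rw [amalgToGroup, Monoid.PushoutI.lift_of]
      exact (hbase _ _ i).trans (this ▸ hbase _ _ _)
    | base h =>
      have : mk A B b g = mk A B b (g * h) := by
        rw [mk_inj]
        simpa using inf_le_amalgFam A B b h.2
      rw [amalgToGroup, Monoid.PushoutI.lift_base]
      exact this ▸ .rfl
    | mul x y hx hy =>
      rw [map_mul, ← mul_assoc]
      exact (hx g b).trans (hy _ b)
  refine (connected_iff_exists_forall_reachable _).2 ⟨mk A B true 1, fun p => ?_⟩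
  obtain ⟨b, g, rfl⟩ := exists_eq_mk p
  obtain ⟨x, rfl⟩ := hsurj g
  simpa using (key x 1 true).trans (hbase _ true b)

theorem even_length_bassSerreTree {p q : BassSerreVertex A B} (w : (bassSerreTree A B).Walk p q) :
    Even w.length ↔ p.1 = q.1 := by
  induction w with
  | nil => simp
  | cons h w ih =>
    rw [Walk.length_cons, Nat.even_add_one, ih]
    obtain ⟨b, g, rfl, rfl⟩ := h
    exact Bool.not_not_eq

/-- The action on the Bass–Serre tree of a splitting over a nontrivial malnormal subgroup. -/
theorem SplitsAsAmalgam.isMalnormalTreeAction [IsMulTorsionFree G] (h : SplitsAsAmalgam A B)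
    (hC : A ⊓ B ≠ ⊥) (hmal : IsMalnormal (A ⊓ B)) :
    IsMalnormalTreeAction G (bassSerreTree A B) := by
  obtain ⟨hA, hB, hinj, hsurj⟩ := h
  have hconn := bassSerreTree_connected hsurj
  have hex (b : Bool) : ∃ x ∈ amalgFam A B b, x ∉ A ⊓ B := by
    by_contra! hle
    cases b
    · exact hB (le_antisymm hle inf_le_right)
    · exact hA (le_antisymm hle inf_le_left)
  refine ⟨⟨hconn, bassSerreTree_isAcyclic hinj⟩, bassSerreTree_adj_smul, ?_, ?_, ?_, ?_, ?_⟩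
  · intro g p
    obtain ⟨w, hw⟩ := hconn.exists_walk_length_eq_dist p (g • p)
    rw [← hw, even_length_bassSerreTree]
    rfl
  · rintro c _ _ r ⟨b, g, rfl, rfl⟩ hr hne h₁ h₂ h₃
    obtain ⟨x, hx, rfl⟩ := bassSerreTree_adj_mk hr
    rw [smul_mk_eq_iff] at h₁ h₂ h₃
    have hxC : x ∉ A ⊓ B := fun hxC => hne (mk_inj.2 (by simpa using inf_le_amalgFam A B _ hxC))
    have hc := mem_inf_of_mem_amalgFam h₁ h₂
    have := hmal x⁻¹ (fun h => hxC (inv_mem_iff.1 h)) _ hc (mem_inf_of_mem_amalgFam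
      (mul_mem (mul_mem (inv_mem hx) h₁) (inv_mem (inv_mem hx))) (by simpa [mul_assoc] using h₃))
    simpa [mul_assoc, mul_eq_one_iff_eq_inv] using this
  · rintro c _ _ n ⟨b, g, rfl, rfl⟩ hn h₁ h₂
    rw [smul_mk_eq_iff] at h₁ h₂
    have hc := mem_inf_of_mem_amalgFam h₁ h₂
    have hpow : g⁻¹ * c ^ n * g = (g⁻¹ * c * g) ^ n := by
      simpa using (conj_zpow (i := n) (a := g⁻¹) (b := c)).symm
    rw [hpow] at hc
    suffices g⁻¹ * c * g ∈ A ⊓ B from ⟨smul_mk_eq_iff.2 (inf_le_amalgFam A B _ this),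
      smul_mk_eq_iff.2 (inf_le_amalgFam A B _ this)⟩
    by_contra hc'
    have := hmal _ hc' _ hc (by rwa [← zpow_one_add, add_comm, zpow_add_one, mul_inv_cancel_right])
    rw [IsMulTorsionFree.zpow_eq_one_iff_left hn] at this
    exact hc' (this ▸ one_mem _)
  · intro p z
    obtain ⟨b, g, rfl⟩ := exists_eq_mk p
    by_contra! hcyc
    obtain ⟨c, hc₁⟩ := Subgroup.ne_bot_iff_exists_ne_one.1 hC
    obtain ⟨x, hx, hxC⟩ := hex b
    have hconj {y : G} (hy : y ∈ amalgFam A B b) : g * y * g⁻¹ ∈ Subgroup.zpowers z :=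
      hcyc _ (smul_mk_eq_iff.2 (by simpa [mul_assoc] using hy))
    obtain ⟨m, hm⟩ := hconj hx
    obtain ⟨n, hn⟩ := hconj (inf_le_amalgFam A B b c.2)
    have hcomm : x * c * x⁻¹ = c := by
      have := (Commute.zpow_zpow_self z m n).eq
      simp only at hm hn
      rw [hm, hn] at this
      rw [mul_inv_eq_iff_eq_mul]
      exact mul_left_cancel (a := g) (by simpa [← mul_assoc] using this)
    exact hc₁ (Subtype.ext (hmal x hxC c c.2 (hcomm.symm ▸ c.2)))
  · intro p
    obtain ⟨b, g, rfl⟩ := exists_eq_mk p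
    by_contra! hfix
    obtain ⟨x, hx, hxC⟩ := hex !b
    have := smul_mk_eq_iff.1 (hfix (g * x * g⁻¹))
    exact hxC (mem_inf_of_mem_amalgFam (by simpa [mul_assoc] using this) hx)

end BassSerre

/-- `F₂` does not split as a proper amalgamated product over a non-trivial malnormal
subgroup. -/
theorem freeGroup_no_malnormal_amalgam :
    ¬ ∃ A B : Subgroup (FreeGroup (Fin 2)),
        A ⊓ B ≠ ⊥ ∧ IsMalnormal (A ⊓ B) ∧ SplitsAsAmalgam A B := by
  rintro ⟨A, B, hC, hmal, h⟩
  refine (h.isMalnormalTreeAction hC hmal).closure_pair_ne_top (.of 0) (.of 1) ?_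
  rw [← FreeGroup.closure_range_of (Fin 2)]
  congr 1
  ext x
  simp [Fin.exists_fin_two, eq_comm]
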